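/- arXiv:2512.10552 — 9 statements merged into one kernel-verified Lean document; each statement's English description precedes it below -/
import Mathlib

section
/- Let a, b, r, q be real parameters with a > 0 and a(r − q) > 0, and let ω > 0 satisfy ω² = 1/(a(r − q)). If t ↦ (x(t), y(t), z(t)) is a solution of the generalized Lorenz system ẋ = −a(x − y), ẏ = (r − z)x − qy, ż = xy − bz, then the rescaled curve t ↦ (X(t), Y(t), Z(t)) defined by X(t) = (ω/√2)·x(ωt), Y(t) = (ω²a/√2)·(y(ωt) − x(ωt)), Z(t) = ω²·(a·z(ωt) − x(ωt)²/2) is a solution of the universal normal form Ẋ = Y, Ẏ = −(X² + Z − 1)X − λY, Ż = −αZ + βX² with parameters λ = (q + a)ω, α = bω, β = (2a − b)ω. -/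
/-- Rescaling a solution of the generalized Lorenz system
`ẋ = −a(x − y), ẏ = (r − z)x − qy, ż = xy − bz` by the map
`X(t) = (ω/√2)·x(ωt)`, `Y(t) = (ω²a/√2)·(y(ωt) − x(ωt))`,
`Z(t) = ω²·(a·z(ωt) − x(ωt)²/2)` yields a solution of the universal normal form
`Ẋ = Y, Ẏ = −(X² + Z − 1)X − λY, Ż = −αZ + βX²` with
`λ = (q + a)ω, α = bω, β = (2a − b)ω`. -/
theorem generalized_lorenz_to_UNF
    (a b r q ω lam α β : ℝ)
    (ha : 0 < a) (harq : 0 < a * (r - q))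
    (hω : 0 < ω) (hω2 : ω ^ 2 = 1 / (a * (r - q)))
    (hlam : lam = (q + a) * ω) (hα : α = b * ω) (hβ : β = (2 * a - b) * ω)
    (I : Set ℝ) (x y z : ℝ → ℝ)
    (hsol : ∀ t ∈ I,
      HasDerivAt x (-a * (x t - y t)) t ∧
      HasDerivAt y ((r - z t) * x t - q * y t) t ∧
      HasDerivAt z (x t * y t - b * z t) t)
    (X Y Z : ℝ → ℝ)
    (hX : ∀ t, X t = (ω / Real.sqrt 2) * x (ω * t))
    (hY : ∀ t, Y t = (ω ^ 2 * a / Real.sqrt 2) * (y (ω * t) - x (ω * t)))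
    (hZ : ∀ t, Z t = ω ^ 2 * (a * z (ω * t) - (x (ω * t)) ^ 2 / 2)) :
    ∀ t, ω * t ∈ I →
      HasDerivAt X (Y t) t ∧
      HasDerivAt Y (-(((X t) ^ 2 + Z t - 1) * X t) - lam * Y t) t ∧
      HasDerivAt Z (-α * Z t + β * (X t) ^ 2) t := by
  intro t ht
  obtain ⟨hx, hy, hz⟩ := hsol (ω * t) ht
  have hscale : HasDerivAt (fun s => ω * s) ω t := by
    simpa using (hasDerivAt_id t).const_mul ω
  have hx' := hx.comp t hscale
  have hy' := hy.comp t hscale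
  have hz' := hz.comp t hscale
  have hωa : ω ^ 2 * (a * (r - q)) = 1 := by
    rw [hω2, one_div_mul_cancel harq.ne']
  have hsqrt : (Real.sqrt 2)⁻¹ ^ 2 = 1 / 2 := by
    rw [inv_pow, Real.sq_sqrt (by norm_num)]
    norm_num
  refine ⟨?_, ?_, ?_⟩
  · rw [funext hX, hY]
    refine (hx'.const_mul (ω / Real.sqrt 2)).congr_deriv ?_
    ring
  · rw [hX, hZ, hY, funext hY, hlam]
    refine ((hy'.sub hx').const_mul (ω ^ 2 * a / Real.sqrt 2)).congr_deriv ?_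
    simp only [div_eq_mul_inv _ (Real.sqrt 2)]
    generalize (Real.sqrt 2)⁻¹ = c at *
    linear_combination ω * c * x (ω * t) * hωa
      + ω ^ 3 * c * x (ω * t) ^ 3 * hsqrt
  · rw [hX, hZ, funext hZ, hα, hβ]
    refine (((hz'.const_mul a).sub ((hx'.pow 2).div_const 2)).const_mul
      (ω ^ 2)).congr_deriv ?_
    simp only [div_eq_mul_inv _ (Real.sqrt 2), Function.comp_apply]
    generalize (Real.sqrt 2)⁻¹ = c at *
    push_cast
    linear_combination -(2 * a - b) * ω ^ 3 * x (ω * t) ^ 2 * hsqrt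
end

section
/- Fix a real number q, and on the domain {(a, b, r) ∈ ℝ³ : a > 0, r > q} define the map P(a, b, r) = ((q + a)ω, bω, (2a − b)ω) where ω = (a(r − q))^{−1/2}. Then P is differentiable and the determinant of its Jacobian matrix at (a, b, r) equals a·ω⁵·q. In particular P is degenerate exactly when q = 0. -/
/-- The Fréchet derivative of `v ↦ (v 0 * (v 2 - q)) ^ (-1/2)` where the base is positive. -/
theorem hasFDerivAt_mul_sub_rpow_neg_half (q : ℝ) (v : Fin 3 → ℝ) (h : 0 < v 0 * (v 2 - q)) :
    HasFDerivAt (fun u : Fin 3 → ℝ => (u 0 * (u 2 - q)) ^ (-(1 : ℝ) / 2))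
      ((-(1 / 2) * ((v 0 * (v 2 - q)) ^ (-(1 : ℝ) / 2)) ^ 3) •
        (v 0 • ContinuousLinearMap.proj (R := ℝ) (φ := fun _ : Fin 3 => ℝ) 2 +
          (v 2 - q) • ContinuousLinearMap.proj (R := ℝ) (φ := fun _ : Fin 3 => ℝ) 0)) v := by
  have hbase := (hasFDerivAt_apply (𝕜 := ℝ) (0 : Fin 3) v).mul
    ((hasFDerivAt_apply (𝕜 := ℝ) (2 : Fin 3) v).sub_const q)
  have hpow : (v 0 * (v 2 - q)) ^ (-(1 : ℝ) / 2 - 1) =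
      ((v 0 * (v 2 - q)) ^ (-(1 : ℝ) / 2)) ^ 3 := by
    rw [← Real.rpow_mul_natCast h.le]
    norm_num
  rw [← hpow, ← neg_div]
  exact hbase.rpow_const (p := -(1 : ℝ) / 2) (Or.inl h.ne')


/-- With `q` fixed, the parameter map
`P(a, b, r) = ((q + a)ω, bω, (2a − b)ω)`, `ω = (a(r − q))^{−1/2}`, defined on
`{a > 0, r > q}`, is differentiable, and the determinant of its Jacobian matrix
at `(a, b, r)` equals `a·ω⁵·q`; in particular `P` is degenerate exactly when
`q = 0`. -/
theorem UNF_parameter_map_jacobian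
    (q : ℝ) (P : (Fin 3 → ℝ) → (Fin 3 → ℝ))
    (hP : ∀ v : Fin 3 → ℝ,
      P v = ![(q + v 0) * (v 0 * (v 2 - q)) ^ (-(1 : ℝ) / 2),
              v 1 * (v 0 * (v 2 - q)) ^ (-(1 : ℝ) / 2),
              (2 * v 0 - v 1) * (v 0 * (v 2 - q)) ^ (-(1 : ℝ) / 2)])
    (a b r : ℝ) (ha : 0 < a) (hr : q < r)
    (ω : ℝ) (hω : ω = (a * (r - q)) ^ (-(1 : ℝ) / 2)) :
    DifferentiableAt ℝ P ![a, b, r] ∧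
    Matrix.det
      (Matrix.of fun i j : Fin 3 =>
        fderiv ℝ (fun u => P u i) ![a, b, r] (Pi.single j 1)) = a * ω ^ 5 * q ∧
    (Matrix.det
      (Matrix.of fun i j : Fin 3 =>
        fderiv ℝ (fun u => P u i) ![a, b, r] (Pi.single j 1)) = 0 ↔ q = 0) := by
  have hs : 0 < a * (r - q) := mul_pos ha (sub_pos.2 hr)
  have hω_pos : 0 < ω := hω ▸ Real.rpow_pos_of_pos hs _
  have hW := hasFDerivAt_mul_sub_rpow_neg_half q ![a, b, r] (by simpa using hs)
  have h0 := hasFDerivAt_apply (𝕜 := ℝ) (0 : Fin 3) ![a, b, r]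
  have h1 := hasFDerivAt_apply (𝕜 := ℝ) (1 : Fin 3) ![a, b, r]
  have hP0 := (h0.const_add q).mul hW
  have hP1 := h1.mul hW
  have hP2 := ((h0.const_mul 2).sub h1).mul hW
  have e0 : (fun u => P u 0) = fun u => (q + u 0) * (u 0 * (u 2 - q)) ^ (-(1 : ℝ) / 2) := by
    ext u; simp [hP]
  have e1 : (fun u => P u 1) = fun u => u 1 * (u 0 * (u 2 - q)) ^ (-(1 : ℝ) / 2) := by
    ext u; simp [hP]
  have e2 : (fun u => P u 2) =
      fun u => (2 * u 0 - u 1) * (u 0 * (u 2 - q)) ^ (-(1 : ℝ) / 2) := by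
    ext u; simp [hP]
  replace hP0 := hP0.congr_of_eventuallyEq (Filter.EventuallyEq.of_eq e0)
  replace hP1 := hP1.congr_of_eventuallyEq (Filter.EventuallyEq.of_eq e1)
  replace hP2 := hP2.congr_of_eventuallyEq (Filter.EventuallyEq.of_eq e2)
  have hdet : Matrix.det (Matrix.of fun i j : Fin 3 =>
      fderiv ℝ (fun u => P u i) ![a, b, r] (Pi.single j 1)) = a * ω ^ 5 * q := by
    simp only [Matrix.det_fin_three, Matrix.of_apply, hP0.fderiv, hP1.fderiv, hP2.fderiv]
    simp [← hω]
    ring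
  refine ⟨differentiableAt_pi.2 fun i => ?_, hdet, ?_⟩
  · fin_cases i
    exacts [hP0.differentiableAt, hP1.differentiableAt, hP2.differentiableAt]
  · simp [hdet, ha.ne', hω_pos.ne']
end

section
/- Let a > 0 and r > q > −a be real numbers, let ω = (a(r − q))^{−1/2}, λ = (q + a)ω, and A = aω. Then: (i) if q > 0 then λ > A (Lorenz-like region); (ii) if q < 0 then 0 < λ < A (Chen-like region); (iii) if q = 0 then λ = A (Tigan line); (iv) in the Chen case r = c − a, q = −c with a/2 < c < a, one has A > 1 and λ = (A² − 1)/(2A) < A; (v) in the Lu case r = 0, q = −c with 0 < c < a, one has A > 1 and λ = (A² − 1)/A < A. -/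
theorem rpow_neg_half_sq_mul_self {x : ℝ} (hx : 0 < x) :
    (x ^ (-(1 : ℝ) / 2)) ^ 2 * x = 1 := by
  rw [← Real.rpow_natCast, ← Real.rpow_mul hx.le]
  norm_num [Real.rpow_neg_one, hx.ne']

/-- With `a > 0`, `r > q > −a`, `ω = (a(r − q))^{−1/2}`,
`λ = (q + a)ω`, `A = aω`:
(i) `q > 0 → λ > A` (Lorenz-like region);
(ii) `q < 0 → 0 < λ < A` (Chen-like region);
(iii) `q = 0 → λ = A` (Tigan line);
(iv) Chen case `r = c − a`, `q = −c`, `a/2 < c < a`: `A > 1` and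
`λ = (A² − 1)/(2A) < A`;
(v) Lu case `r = 0`, `q = −c`, `0 < c < a`: `A > 1` and
`λ = (A² − 1)/A < A`. -/
theorem lorenz_chen_lu_tigan_regions
    (a r q ω lam A : ℝ)
    (ha : 0 < a) (hrq : q < r) (hqa : -a < q)
    (hω : ω = (a * (r - q)) ^ (-(1 : ℝ) / 2))
    (hlam : lam = (q + a) * ω) (hA : A = a * ω) :
    (0 < q → A < lam) ∧
    (q < 0 → 0 < lam ∧ lam < A) ∧
    (q = 0 → lam = A) ∧
    (∀ c : ℝ, a / 2 < c → c < a → r = c - a → q = -c →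
      1 < A ∧ lam = (A ^ 2 - 1) / (2 * A) ∧ lam < A) ∧
    (∀ c : ℝ, 0 < c → c < a → r = 0 → q = -c →
      1 < A ∧ lam = (A ^ 2 - 1) / A ∧ lam < A) := by
  have hx : 0 < a * (r - q) := mul_pos ha (sub_pos.2 hrq)
  have hω_pos : 0 < ω := hω ▸ Real.rpow_pos_of_pos hx _
  have hω_sq : ω ^ 2 * (a * (r - q)) = 1 := hω ▸ rpow_neg_half_sq_mul_self hx
  have hA_pos : 0 < A := hA ▸ mul_pos ha hω_pos
  have hA_gt_one (h : r - q < a) : 1 < A := by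
    have hA_sq : A ^ 2 * (r - q) = a := by
      rw [hA]
      linear_combination a * hω_sq
    by_contra! hle
    nlinarith [pow_le_one₀ (n := 2) hA_pos.le hle]
  have hlam_lt (h : q < 0) : lam < A := by
    rw [hlam, hA]
    exact mul_lt_mul_of_pos_right (by linarith) hω_pos
  refine ⟨fun h => ?_, fun h => ⟨?_, hlam_lt h⟩, fun h => ?_, ?_, ?_⟩
  · rw [hlam, hA]
    exact mul_lt_mul_of_pos_right (by linarith) hω_pos
  · rw [hlam]
    exact mul_pos (by linarith) hω_pos
  · rw [hlam, hA, h, zero_add]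
  · rintro c hc hca rfl rfl
    refine ⟨hA_gt_one (by linarith), ?_, hlam_lt (by linarith)⟩
    rw [eq_div_iff (by positivity), hlam, hA]
    linear_combination -hω_sq
  · rintro c hc hca rfl rfl
    refine ⟨hA_gt_one (by linarith), ?_, hlam_lt (by linarith)⟩
    rw [eq_div_iff hA_pos.ne', hlam, hA]
    linear_combination -hω_sq
end

section
/- Let λ, α, β > 0, set m = 2 + αβ + α² and λ_s = (√(m² + 8β(α + β)) − m)/(2(α + β)). Then the characteristic polynomial of the Jacobian matrix of the universal normal form at the equilibrium E⁺ = (√(α/(α + β)), 0, β/(α + β)) equals p(s) = s³ + (λ + α)s² + α(λ + 2/(α + β))s + 2α, and every complex root of p has negative real part if and only if λ > λ_s. In particular the equilibria E± = (±√(α/(α + β)), 0, β/(α + β)) are linearly asymptotically stable exactly for λ > λ_s. -/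
/-- A real cubic with positive coefficients and `a * b ≤ c` has a root outside the open left
half-plane: it has a real root `r ≤ -a`, and the other two roots sum to `-(a + r) ≥ 0`. -/
theorem exists_cubic_root_re_nonneg {a b c : ℝ} (ha : 0 < a) (hb : 0 < b)
    (hc : 0 < c) (h : a * b ≤ c) :
    ∃ s : ℂ, s ^ 3 + (a : ℂ) * s ^ 2 + (b : ℂ) * s + (c : ℂ) = 0 ∧ 0 ≤ s.re := by
  obtain ⟨r, hr, hr0⟩ : ∃ r ≤ -a, r ^ 3 + a * r ^ 2 + b * r + c = 0 := by
    have hd : 0 < c / b := div_pos hc hb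
    have hcb : b * (c / b) = c := by field_simp
    have hcont : ContinuousOn (fun x : ℝ => x ^ 3 + a * x ^ 2 + b * x + c)
        (Set.Icc (-a - c / b) (-a)) := by fun_prop
    obtain ⟨r, hr, hr0⟩ := intermediate_value_Icc (by linarith) hcont
      (show (0 : ℝ) ∈ Set.Icc _ _ from
        ⟨by nlinarith [mul_nonneg hd.le (sq_nonneg (a + c / b)), mul_pos ha hb], by nlinarith⟩)
    exact ⟨r, hr.2, hr0⟩
  obtain ⟨w, hw, hw0⟩ : ∃ w : ℂ,
      w ^ 2 = ((a : ℂ) + r) ^ 2 - 4 * ((b : ℂ) + r * (a + r)) ∧ 0 ≤ w.re := by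
    obtain ⟨w, hw⟩ := IsAlgClosed.exists_pow_nat_eq
      (((a : ℂ) + r) ^ 2 - 4 * ((b : ℂ) + r * (a + r))) (n := 2) (by norm_num)
    rcases le_total 0 w.re with h0 | h0
    · exact ⟨w, hw, h0⟩
    · exact ⟨-w, by rw [neg_sq, hw], by simpa using h0⟩
  have hr0' : (r : ℂ) ^ 3 + a * r ^ 2 + b * r + c = 0 := by exact_mod_cast hr0
  have hs : (((-(a + r) / 2 : ℝ) : ℂ) + ((1 / 2 : ℝ) : ℂ) * w).re =
      -(a + r) / 2 + 1 / 2 * w.re := by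
    rw [Complex.add_re, Complex.re_ofReal_mul, Complex.ofReal_re]
  refine ⟨((-(a + r) / 2 : ℝ) : ℂ) + ((1 / 2 : ℝ) : ℂ) * w, ?_, by rw [hs]; linarith⟩
  push_cast
  linear_combination
    (-((a : ℂ) + r) / 2 + 1 / 2 * w - r) / 4 * hw + hr0'

/-- Routh–Hurwitz criterion for a real cubic with positive coefficients. -/
theorem cubic_roots_re_neg_iff {a b c : ℝ} (ha : 0 < a) (hb : 0 < b) (hc : 0 < c) :
    (∀ s : ℂ, s ^ 3 + (a : ℂ) * s ^ 2 + (b : ℂ) * s + (c : ℂ) = 0 → s.re < 0) ↔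
      c < a * b := by
  constructor
  · intro h
    by_contra! hab
    obtain ⟨s, hs, hs0⟩ := exists_cubic_root_re_nonneg ha hb hc hab
    exact (h s hs).not_ge hs0
  · rintro hab ⟨x, y⟩ hs
    by_contra! hx
    change 0 ≤ x at hx
    have hre := congrArg Complex.re hs
    have him := congrArg Complex.im hs
    simp only [pow_succ, pow_zero, one_mul, Complex.add_re, Complex.mul_re, Complex.mul_im,
      Complex.ofReal_re, Complex.ofReal_im, Complex.add_im, Complex.zero_re,
      Complex.zero_im] at hre him
    have him' : y * (3 * x ^ 2 - y ^ 2 + 2 * a * x + b) = 0 := by linear_combination him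
    rcases mul_eq_zero.mp him' with hy | hy
    · subst hy
      have : x ^ 3 + a * x ^ 2 + b * x + c = 0 := by linear_combination hre
      have : 0 < x ^ 3 + a * x ^ 2 + b * x + c := by positivity
      linarith
    · have : 8 * x ^ 3 + 8 * a * x ^ 2 + (2 * b + 2 * a ^ 2) * x + (a * b - c) = 0 := by
        linear_combination -hre + (3 * x + a) * hy
      have : 0 ≤ 8 * x ^ 3 + 8 * a * x ^ 2 + (2 * b + 2 * a ^ 2) * x := by positivity
      linarith

/-- The larger root of `k x² + m x - n` separates the signs on the positive half-line. -/
theorem quadratic_root_lt_iff {k m n x : ℝ} (hk : 0 < k) (hm : 0 < m) (hx : 0 < x) :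
    (Real.sqrt (m ^ 2 + 4 * n * k) - m) / (2 * k) < x ↔ n < k * x ^ 2 + m * x := by
  rw [div_lt_iff₀ (by positivity), sub_lt_iff_lt_add, Real.sqrt_lt' (by positivity)]
  rw [← sub_pos, show (x * (2 * k) + m) ^ 2 - (m ^ 2 + 4 * n * k) =
    4 * k * (k * x ^ 2 + m * x - n) by ring, mul_pos_iff_of_pos_left (by positivity), sub_pos]

/-- For `λ, α, β > 0`, with `m = 2 + αβ + α²` and
`λ_s = (√(m² + 8β(α + β)) − m)/(2(α + β))`, the characteristic polynomial of
the Jacobian of the universal normal form at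
`E⁺ = (√(α/(α + β)), 0, β/(α + β))` is
`p(s) = s³ + (λ + α)s² + α(λ + 2/(α + β))s + 2α`, and every complex root of
`p` has negative real part iff `λ > λ_s`; i.e. `E±` are linearly
asymptotically stable exactly for `λ > λ_s`. -/
theorem UNF_equilibria_stability
    (lam α β m lam_s : ℝ) (hlam : 0 < lam) (hα : 0 < α) (hβ : 0 < β)
    (hm : m = 2 + α * β + α ^ 2)
    (hls : lam_s = (Real.sqrt (m ^ 2 + 8 * β * (α + β)) - m) / (2 * (α + β)))
    (F : (Fin 3 → ℝ) → Fin 3 → ℝ)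
    (hF : ∀ v : Fin 3 → ℝ,
      F v = ![v 1, -(((v 0) ^ 2 + v 2 - 1) * v 0) - lam * v 1,
              -α * v 2 + β * (v 0) ^ 2])
    (Eplus : Fin 3 → ℝ)
    (hE : Eplus = ![Real.sqrt (α / (α + β)), 0, β / (α + β)]) :
    (∀ s : ℝ, Matrix.det (s • (1 : Matrix (Fin 3) (Fin 3) ℝ) -
        Matrix.of fun i j : Fin 3 =>
          fderiv ℝ (fun v => F v i) Eplus (Pi.single j 1)) =
      s ^ 3 + (lam + α) * s ^ 2 + α * (lam + 2 / (α + β)) * s + 2 * α) ∧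
    ((∀ s : ℂ, s ^ 3 + ((lam : ℂ) + (α : ℂ)) * s ^ 2 +
        (α : ℂ) * ((lam : ℂ) + 2 / ((α : ℂ) + (β : ℂ))) * s + 2 * (α : ℂ) = 0 →
        s.re < 0) ↔ lam_s < lam) := by
  subst hE hm hls
  have hk : 0 < α + β := add_pos hα hβ
  constructor
  · intro s
    have hsq : Real.sqrt (α / (α + β)) ^ 2 = α / (α + β) := Real.sq_sqrt (by positivity)
    set x := Real.sqrt (α / (α + β))
    set E : Fin 3 → ℝ := ![x, 0, β / (α + β)]
    have hp (i : Fin 3) : HasFDerivAt (fun v : Fin 3 → ℝ => v i)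
        (ContinuousLinearMap.proj (R := ℝ) (φ := fun _ : Fin 3 => ℝ) i) E := hasFDerivAt_apply i E
    have h0 := hp 1
    have h1 := ((((hp 0).pow 2).add (hp 2)).sub_const 1 |>.mul (hp 0)).neg.sub
      ((hp 1).const_mul lam)
    have h2 := ((hp 2).const_mul (-α)).add (((hp 0).pow 2).const_mul β)
    have f0 := (h0.congr_of_eventuallyEq (f₁ := fun v => F v 0)
      (.of_forall fun v => by simp [hF])).fderiv
    have f1 := (h1.congr_of_eventuallyEq (f₁ := fun v => F v 1)
      (.of_forall fun v => by simp [hF])).fderiv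
    have f2 := (h2.congr_of_eventuallyEq (f₁ := fun v => F v 2)
      (.of_forall fun v => by simp [hF])).fderiv
    rw [Matrix.det_fin_three]
    simp [f0, f1, f2, E]
    have hu : (α + β) * (α + β)⁻¹ = 1 := mul_inv_cancel₀ hk.ne'
    linear_combination (3 * (s + α) + 2 * β) * hsq + (s + 3 * α) * hu
  · have hRH := cubic_roots_re_neg_iff (a := lam + α) (b := α * (lam + 2 / (α + β)))
      (c := 2 * α) (by positivity) (by positivity) (by positivity)
    push_cast at hRH
    rw [hRH, show 8 * β * (α + β) = 4 * (2 * β) * (α + β) by ring,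
      quadratic_root_lt_iff hk (by positivity) hlam]
    have e : (lam + α) * (α * (lam + 2 / (α + β))) - 2 * α =
        α / (α + β) * ((α + β) * lam ^ 2 + (2 + α * β + α ^ 2) * lam - 2 * β) := by
      field_simp
      ring
    rw [← sub_pos, e, mul_pos_iff_of_pos_left (by positivity), sub_pos]
end

section
/- Let α, β > 0 and let t ↦ (x(t), y(t), z(t)) be a solution of the universal normal form. (i) At any time t where x(t) > 0, y(t) > 0 and z(t) = β·x(t)²/α, the derivative of the function t ↦ z(t) − β·x(t)²/α equals −(2β/α)·x(t)·y(t) < 0. (ii) At any time t where x(t) > y(t) > 0 and z(t) = β·x(t)²/(α + 2), the derivative of the function t ↦ z(t) − β·x(t)²/(α + 2) equals (2β/(α + 2))·x(t)·(x(t) − y(t)) > 0. Hence on both boundary surfaces z = βx²/α and z = βx²/(α + 2) of the region g^u the vector field points into g^u. -/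
/-- The derivative of `t ↦ z − βx²/c` along functions with `ẋ = y` and `ż = −αz + βx²`,
at a time where `z = βx²/c`. -/
theorem hasDerivAt_sub_mul_sq_div {α β c t : ℝ} {x y z : ℝ → ℝ} (hc : c ≠ 0)
    (hx : HasDerivAt x (y t) t) (hz : HasDerivAt z (-α * z t + β * (x t) ^ 2) t)
    (h : z t = β * (x t) ^ 2 / c) :
    HasDerivAt (fun s => z s - β * (x s) ^ 2 / c)
      ((β / c) * (x t * ((c - α) * x t - 2 * y t))) t := by
  refine (hz.sub (((hx.pow 2).const_mul β).div_const c)).congr_deriv ?_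
  rw [h]
  field_simp
  ring

/-- For `α, β > 0` and a solution of the universal normal form:
(i) where `x > 0`, `y > 0`, `z = βx²/α`, the derivative of
`t ↦ z − βx²/α` equals `−(2β/α)xy < 0`;
(ii) where `x > y > 0`, `z = βx²/(α + 2)`, the derivative of
`t ↦ z − βx²/(α + 2)` equals `(2β/(α + 2))x(x − y) > 0`.
Hence the vector field points into `g^u` on both boundary surfaces. -/
theorem UNF_entering_gu_region
    (lam α β : ℝ) (hα : 0 < α) (hβ : 0 < β)
    (I : Set ℝ) (x y z : ℝ → ℝ)
    (hsol : ∀ t ∈ I,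
      HasDerivAt x (y t) t ∧
      HasDerivAt y (-(((x t) ^ 2 + z t - 1) * x t) - lam * y t) t ∧
      HasDerivAt z (-α * z t + β * (x t) ^ 2) t) :
    ∀ t ∈ I,
      (0 < x t → 0 < y t → z t = β * (x t) ^ 2 / α →
        HasDerivAt (fun s => z s - β * (x s) ^ 2 / α)
          (-(2 * β / α) * (x t * y t)) t ∧
        -(2 * β / α) * (x t * y t) < 0) ∧
      (y t < x t → 0 < y t → z t = β * (x t) ^ 2 / (α + 2) →
        HasDerivAt (fun s => z s - β * (x s) ^ 2 / (α + 2))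
          ((2 * β / (α + 2)) * (x t * (x t - y t))) t ∧
        0 < (2 * β / (α + 2)) * (x t * (x t - y t))) := by
  intro t ht
  obtain ⟨hx, -, hz⟩ := hsol t ht
  refine ⟨fun hx0 hy0 h => ⟨?_, ?_⟩, fun hxy hy0 h => ⟨?_, ?_⟩⟩
  · exact (hasDerivAt_sub_mul_sq_div hα.ne' hx hz h).congr_deriv (by ring)
  · rw [neg_mul, neg_lt_zero]
    positivity
  · exact (hasDerivAt_sub_mul_sq_div (by positivity) hx hz h).congr_deriv (by ring)
  · have hx0 : 0 < x t := hy0.trans hxy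
    have hsub : 0 < x t - y t := sub_pos.2 hxy
    positivity
end

section
/- Let λ, α, z₀ ∈ ℝ and set a(t) = z₀·e^{−αt} − 1 − λ²/4. Consider the nonautonomous linear system ẋ = y, ẏ = −(z₀·e^{−αt} − 1)x − λy. Let η be a differentiable real function, let (x(t), y(t)) be any solution, and set w(t) = y(t) + (λ/2 + η(t))·x(t). Then w′(t) = (η(t) − λ/2)·w(t) + (η′(t) − a(t) − η(t)²)·x(t) for all t. Consequently, if η solves the Riccati equation η′ = a(t) + η², then w satisfies the linear equation w′ = (η − λ/2)w; hence any solution with w(t₀) = 0 at some time t₀ satisfies w ≡ 0, i.e., the moving line {y = −(λ/2 + η(t))x} is an integral manifold of the system. -/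
/-- A solution of a scalar linear homogeneous equation `w′ = p(t)w` with continuous coefficient
that vanishes at one time vanishes identically. -/
theorem eq_zero_of_hasDerivAt_mul_self {p w : ℝ → ℝ} (hp : Continuous p)
    (hw : ∀ t, HasDerivAt w (p t * w t) t) {t₀ : ℝ} (h₀ : w t₀ = 0) (t : ℝ) : w t = 0 := by
  have hP (s : ℝ) : HasDerivAt (fun u => ∫ v in t₀..u, p v) (p s) s :=
    hp.integral_hasStrictDerivAt t₀ s |>.hasDerivAt
  have hd (s : ℝ) : HasDerivAt (fun u => w u * Real.exp (-∫ v in t₀..u, p v)) 0 s := by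
    refine ((hw s).mul (hP s).neg.exp).congr_deriv ?_
    simp only [Pi.neg_apply]
    ring
  have hconst := is_const_of_deriv_eq_zero (fun s => (hd s).differentiableAt)
    (fun s => (hd s).deriv) t t₀
  simpa [h₀, Real.exp_ne_zero] using hconst


/-- For the linearization `ẋ = y, ẏ = −(z₀e^{−αt} − 1)x − λy`
of the universal normal form along the invariant line, with
`a(t) = z₀e^{−αt} − 1 − λ²/4` and `w = y + (λ/2 + η)x`, one has
`w′ = (η − λ/2)w + (η′ − a − η²)x`; hence if `η` solves the Riccati equation
`η′ = a(t) + η²`, then `w′ = (η − λ/2)w`, and any solution with `w(t₀) = 0`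
satisfies `w ≡ 0`, i.e. the moving line `{y = −(λ/2 + η(t))x}` is an
integral manifold. -/
theorem UNF_linearization_riccati_manifold
    (lam α z₀ : ℝ) (a : ℝ → ℝ)
    (ha : ∀ t, a t = z₀ * Real.exp (-α * t) - 1 - lam ^ 2 / 4)
    (η η' : ℝ → ℝ) (hη : ∀ t, HasDerivAt η (η' t) t)
    (x y : ℝ → ℝ)
    (hsol : ∀ t,
      HasDerivAt x (y t) t ∧
      HasDerivAt y (-(z₀ * Real.exp (-α * t) - 1) * x t - lam * y t) t)
    (w : ℝ → ℝ) (hw : ∀ t, w t = y t + (lam / 2 + η t) * x t) :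
    (∀ t, HasDerivAt w
        ((η t - lam / 2) * w t + (η' t - a t - (η t) ^ 2) * x t) t) ∧
    ((∀ t, η' t = a t + (η t) ^ 2) →
      (∀ t, HasDerivAt w ((η t - lam / 2) * w t) t) ∧
      ∀ t₀ : ℝ, w t₀ = 0 → ∀ t, w t = 0) := by
  have hderiv (t : ℝ) : HasDerivAt w
      ((η t - lam / 2) * w t + (η' t - a t - (η t) ^ 2) * x t) t := by
    have hw_eq : w = fun t => y t + (lam / 2 + η t) * x t := funext hw
    rw [hw_eq]
    refine ((hsol t).2.add (((hη t).const_add (lam / 2)).mul (hsol t).1)).congr_deriv ?_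
    simp only [ha]
    ring
  refine ⟨hderiv, fun hric => ?_⟩
  have hlin (t : ℝ) : HasDerivAt w ((η t - lam / 2) * w t) t := by
    refine (hderiv t).congr_deriv ?_
    rw [hric]
    ring
  have hη_cont : Continuous η :=
    continuous_iff_continuousAt.2 fun t => (hη t).continuousAt
  exact ⟨hlin, fun t₀ h₀ =>
    eq_zero_of_hasDerivAt_mul_self (hη_cont.sub continuous_const) hlin h₀⟩
end

section
/- Let λ > 0, α > 0, set κ = √(1 + λ²/4) and a(t) = κ²·e^{−αt} − κ² (i.e., a(t) = z₀e^{−αt} − 1 − λ²/4 with z₀ = 1 + λ²/4). Then the Riccati equation η′ = a(t) + η² has a solution η_s defined on all of [0, ∞) with 0 < η_s(t) < κ for all t > 0 and η_s(t) → κ as t → ∞; moreover η_s is the unique solution of this equation defined on all of [0, ∞) whose values remain in the interval (0, κ). -/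
open Filter Set Topology in
/-- A function on `[T, ∞)` with nonpositive derivative and limit `0` is nonnegative. -/
theorem nonneg_of_hasDerivAt_nonpos_of_tendsto_zero {h h' : ℝ → ℝ} {T : ℝ}
    (hd : ∀ t ≥ T, HasDerivAt h (h' t) t) (hneg : ∀ t > T, h' t ≤ 0)
    (hlim : Tendsto h atTop (𝓝 0)) {t : ℝ} (ht : T ≤ t) : 0 ≤ h t := by
  have hanti : AntitoneOn h (Ici T) := by
    refine antitoneOn_of_deriv_nonpos (convex_Ici T)
      (fun x hx => (hd x hx).continuousAt.continuousWithinAt) ?_ ?_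
    · intro x hx
      rw [interior_Ici] at hx
      exact (hd x hx.le).differentiableAt.differentiableWithinAt
    · intro x hx
      rw [interior_Ici] at hx
      rw [(hd x hx.le).deriv]
      exact hneg x hx
  refine le_of_tendsto hlim ?_
  filter_upwards [eventually_ge_atTop t] with x hx
  exact hanti ht (ht.trans hx) hx

open Filter Set Topology in
/-- A function on `[T, ∞)` with negative derivative and limit `0` is positive. -/
theorem pos_of_hasDerivAt_neg_of_tendsto_zero {h h' : ℝ → ℝ} {T : ℝ}
    (hd : ∀ t ≥ T, HasDerivAt h (h' t) t) (hneg : ∀ t > T, h' t < 0)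
    (hlim : Tendsto h atTop (𝓝 0)) {t : ℝ} (ht : T ≤ t) : 0 < h t := by
  have hanti : StrictAntiOn h (Ici T) := by
    refine strictAntiOn_of_deriv_neg (convex_Ici T)
      (fun x hx => (hd x hx).continuousAt.continuousWithinAt) ?_
    intro x hx
    rw [interior_Ici] at hx
    rw [(hd x hx.le).deriv]
    exact hneg x hx
  have h1 : T ≤ t + 1 := by linarith
  exact (nonneg_of_hasDerivAt_nonpos_of_tendsto_zero hd (fun x hx => (hneg x hx).le) hlim
    h1).trans_lt (hanti ht h1 (by linarith))

theorem summable_mul_pow_of_abs_le {c : ℕ → ℝ} {A M : ℝ}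
    (hc : ∀ n, |c n| ≤ A * (M ^ n / n.factorial)) (s : ℝ) :
    Summable fun n => c n * s ^ n := by
  refine Summable.of_norm_bounded (g := fun n => A * ((M * |s|) ^ n / n.factorial))
    ((Real.summable_pow_div_factorial _).mul_left A) fun n => ?_
  rw [Real.norm_eq_abs, abs_mul, abs_pow, mul_pow]
  calc |c n| * |s| ^ n ≤ A * (M ^ n / n.factorial) * |s| ^ n := by gcongr; exact hc n
    _ = _ := by ring

theorem abs_succ_mul_le {c : ℕ → ℝ} {A M : ℝ}
    (hc : ∀ n, |c n| ≤ A * (M ^ n / n.factorial)) (n : ℕ) :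
    |(n + 1) * c (n + 1)| ≤ A * M * (M ^ n / n.factorial) := by
  have hn : (0 : ℝ) < n + 1 := by positivity
  have hf : (0 : ℝ) < n.factorial := by positivity
  rw [abs_mul, abs_of_pos hn]
  calc (n + 1) * |c (n + 1)| ≤ (n + 1) * (A * (M ^ (n + 1) / (n + 1).factorial)) := by
        gcongr; exact hc _
    _ = _ := by rw [Nat.factorial_succ]; push_cast; field_simp; ring

/-- Term-by-term differentiation of an entire power series of exponential type. -/
theorem hasDerivAt_tsum_mul_pow {c : ℕ → ℝ} {A M : ℝ}
    (hc : ∀ n, |c n| ≤ A * (M ^ n / n.factorial)) (s : ℝ) :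
    HasDerivAt (fun s => ∑' n, c n * s ^ n) (∑' n, (n + 1) * c (n + 1) * s ^ n) s := by
  set R := |s| + 1
  have hR : 0 < R := by positivity
  have hsR : s ∈ Metric.ball (0 : ℝ) R := by simp [R]
  have hu : Summable fun n : ℕ => |c n * (n * R ^ (n - 1))| := by
    rw [← summable_nat_add_iff 1]
    refine (summable_mul_pow_of_abs_le (abs_succ_mul_le hc) R).abs.congr fun n => ?_
    rw [Nat.add_sub_cancel, ← mul_assoc, mul_comm (c _)]
    push_cast
    rfl
  have hb : ∀ n : ℕ, ∀ y ∈ Metric.ball (0 : ℝ) R,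
      ‖c n * (n * y ^ (n - 1))‖ ≤ |c n * (n * R ^ (n - 1))| := by
    intro n y hy
    have hy' : |y| ≤ |R| := by
      rw [abs_of_pos hR]
      simpa using (mem_ball_zero_iff.1 hy).le
    rw [Real.norm_eq_abs]
    simp only [abs_mul, abs_pow]
    gcongr
  have hmain := hasDerivAt_tsum_of_isPreconnected hu Metric.isOpen_ball
    (convex_ball (0 : ℝ) R).isPreconnected
    (fun n y _ => (hasDerivAt_pow n y).const_mul (c n)) hb hsR
    (summable_mul_pow_of_abs_le hc s) hsR
  convert! hmain using 1
  have hsum : Summable fun n : ℕ => c n * (n * s ^ (n - 1)) :=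
    Summable.of_norm_bounded hu fun n => hb n s hsR
  rw [hsum.tsum_eq_zero_add]
  simp only [Nat.cast_zero, zero_mul, mul_zero, zero_add, Nat.add_sub_cancel]
  exact tsum_congr fun n => by push_cast; ring

/-- The Taylor coefficients at `0` of the entire solution of
`α² (s f'' + f') + 2 κ α f' = -κ² f`, normalized by `f 0 = 1`. -/
noncomputable def besselCoeff (κ α : ℝ) : ℕ → ℝ
  | 0 => 1
  | n + 1 => -κ ^ 2 / ((n + 1) * α * (2 * κ + (n + 1) * α)) * besselCoeff κ α n

theorem abs_besselCoeff_le {κ α : ℝ} (hκ : 0 < κ) (hα : 0 < α) (n : ℕ) :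
    |besselCoeff κ α n| ≤ 1 * ((κ / α) ^ n / n.factorial) := by
  induction n with
  | zero => simp [besselCoeff]
  | succ n ih =>
    have hden : (n + 1) * α * κ ≤ (n + 1) * α * (2 * κ + (n + 1) * α) := by
      have : 0 < (n + 1) * α := by positivity
      gcongr
      linarith
    rw [besselCoeff, abs_mul, abs_div, abs_neg, abs_of_pos (by positivity : 0 < κ ^ 2),
      abs_of_pos (by positivity : 0 < (n + 1) * α * (2 * κ + (n + 1) * α))]
    calc _ ≤ κ ^ 2 / ((n + 1) * α * κ) * (1 * ((κ / α) ^ n / n.factorial)) := by gcongr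
      _ = _ := by rw [Nat.factorial_succ, pow_succ (κ / α)]; push_cast; field_simp

theorem exists_entire_solution {κ α : ℝ} (hκ : 0 < κ) (hα : 0 < α) :
    ∃ f f₁ f₂ : ℝ → ℝ, f 0 = 1 ∧ (∀ s, HasDerivAt f (f₁ s) s) ∧
      (∀ s, HasDerivAt f₁ (f₂ s) s) ∧
      ∀ s, α ^ 2 * (s * f₂ s + f₁ s) + 2 * κ * α * f₁ s = -κ ^ 2 * f s := by
  have b₀ := abs_besselCoeff_le hκ hα
  have b₁ := abs_succ_mul_le b₀
  have hd₁ := hasDerivAt_tsum_mul_pow (c := fun n : ℕ => (n + 1) * besselCoeff κ α (n + 1)) b₁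
  have b₂ := abs_succ_mul_le (c := fun n : ℕ => (n + 1) * besselCoeff κ α (n + 1)) b₁
  refine ⟨_, _, _, ?_, hasDerivAt_tsum_mul_pow b₀, hd₁, fun s => ?_⟩
  · rw [tsum_eq_single 0 fun n hn => by simp [hn]]
    simp [besselCoeff]
  · have s₀ := summable_mul_pow_of_abs_le b₀ s
    have s₁ := summable_mul_pow_of_abs_le b₁ s
    have s₂ := (summable_mul_pow_of_abs_le b₂ s).mul_left s
    have h₂ : HasSum
        (fun n : ℕ => (n : ℝ) * ((n + 1) * besselCoeff κ α (n + 1)) * s ^ n)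
        (s * ∑' n : ℕ, ((n : ℝ) + 1) * (((n + 1 : ℕ) + 1) * besselCoeff κ α (n + 1 + 1)) *
          s ^ n) := by
      rw [← hasSum_nat_add_iff' 1, ← tsum_mul_left]
      simp only [Finset.range_one, Finset.sum_singleton, Nat.cast_zero, zero_mul, sub_zero]
      convert! s₂.hasSum using 2 with n
      push_cast
      ring
    refine (((h₂.add s₁.hasSum).mul_left (α ^ 2)).add (s₁.hasSum.mul_left (2 * κ * α))).unique ?_
    convert! s₀.hasSum.mul_left (-κ ^ 2) using 2 with n
    rw [besselCoeff]
    have : 2 * κ + (n + 1) * α ≠ 0 := by positivity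
    field_simp
    ring

open Filter Set Topology in
theorem exists_decaying_linear_solution {κ α : ℝ} (hκ : 0 < κ) (hα : 0 < α) :
    ∃ w p : ℝ → ℝ, (∀ t, HasDerivAt w (p t) t) ∧
      (∀ t, HasDerivAt p (2 * κ * p t - κ ^ 2 * Real.exp (-α * t) * w t) t) ∧
      Tendsto w atTop (𝓝 1) ∧ Tendsto p atTop (𝓝 0) := by
  obtain ⟨f, f₁, f₂, h0, hf, hf₁, hode⟩ := exists_entire_solution hκ hα
  have hE : ∀ t, HasDerivAt (fun t => Real.exp (-α * t)) (Real.exp (-α * t) * (-α)) t :=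
    fun t => by simpa using ((hasDerivAt_id t).const_mul (-α)).exp
  have hlim : Tendsto (fun t => Real.exp (-α * t)) atTop (𝓝 0) :=
    Real.tendsto_exp_atBot.comp (tendsto_id.const_mul_atTop_of_neg (neg_lt_zero.2 hα))
  refine ⟨fun t => f (Real.exp (-α * t)),
    fun t => f₁ (Real.exp (-α * t)) * (Real.exp (-α * t) * (-α)),
    fun t => (hf _).comp t (hE t), fun t => ?_, ?_, ?_⟩
  · convert! ((hf₁ _).comp t (hE t)).mul ((hE t).mul_const (-α)) using 1
    simp only [Function.comp]
    linear_combination (-Real.exp (-α * t)) * hode (Real.exp (-α * t))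
  · rw [← h0]
    exact (hf 0).continuousAt.tendsto.comp hlim
  · simpa using ((hf₁ 0).continuousAt.tendsto.comp hlim).mul (hlim.mul_const (-α))

open Filter Set Topology in
theorem exists_positive_linear_solution {κ α : ℝ} (hκ : 0 < κ) (hα : 0 < α) :
    ∃ w p : ℝ → ℝ, (∀ t, HasDerivAt w (p t) t) ∧
      (∀ t, HasDerivAt p (2 * κ * p t - κ ^ 2 * Real.exp (-α * t) * w t) t) ∧
      Tendsto w atTop (𝓝 1) ∧ Tendsto p atTop (𝓝 0) ∧
      ∀ t ≥ 0, 0 < w t ∧ 0 < p t ∧ p t < κ * w t := by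
  obtain ⟨w, p, hw, hp, hw1, hp0⟩ := exists_decaying_linear_solution hκ hα
  refine ⟨w, p, hw, hp, hw1, hp0, ?_⟩
  have hE : ∀ r t : ℝ, HasDerivAt (fun t => Real.exp (-r * t)) (Real.exp (-r * t) * (-r)) t :=
    fun r t => by simpa using ((hasDerivAt_id t).const_mul (-r)).exp
  have hElim : ∀ r > 0, Tendsto (fun t => Real.exp (-r * t)) atTop (𝓝 0) := fun r hr =>
    Real.tendsto_exp_atBot.comp (tendsto_id.const_mul_atTop_of_neg (neg_lt_zero.2 hr))
  have hs : ∀ t > 0, Real.exp (-α * t) < 1 := fun t ht =>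
    Real.exp_lt_one_iff.2 (by nlinarith [mul_pos hα ht])
  have hg : ∀ t, HasDerivAt (fun t => κ * w t - p t) _ t :=
    fun t => ((hw t).const_mul κ).sub (hp t)
  have hglim : Tendsto (fun t => κ * w t - p t) atTop (𝓝 (κ * 1 - 0)) :=
    (hw1.const_mul κ).sub hp0
  have hprod : ∀ t ≥ 0, 0 ≤ Real.exp (-(2 * κ) * t) * (w t * (κ * w t - p t)) := by
    intro t ht
    refine nonneg_of_hasDerivAt_nonpos_of_tendsto_zero (T := 0)
      (h := fun t => Real.exp (-(2 * κ) * t) * (w t * (κ * w t - p t)))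
      (h' := fun t => -(Real.exp (-(2 * κ) * t) *
        ((κ * w t - p t) ^ 2 + κ ^ 2 * (1 - Real.exp (-α * t)) * w t ^ 2)))
      (fun t _ => ?_) (fun t ht => ?_) ?_ ht
    · convert! (hE (2 * κ) t).mul ((hw t).mul (hg t)) using 1
      simp only [Pi.mul_apply]
      ring
    · have := sub_pos.2 (hs t ht)
      rw [neg_nonpos]
      positivity
    · simpa using (hElim (2 * κ) (by positivity)).mul (hw1.mul hglim)
  have hsq : AntitoneOn (fun t => Real.exp (-(2 * κ) * t) * w t ^ 2) (Ici 0) := by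
    have hd : ∀ t, HasDerivAt (fun t => Real.exp (-(2 * κ) * t) * w t ^ 2)
        (-2 * (Real.exp (-(2 * κ) * t) * (w t * (κ * w t - p t)))) t := fun t => by
      convert! (hE (2 * κ) t).mul ((hw t).pow 2) using 1
      simp
      ring
    refine antitoneOn_of_deriv_nonpos (convex_Ici 0)
      (fun x _ => (hd x).continuousAt.continuousWithinAt)
      (fun x _ => (hd x).differentiableAt.differentiableWithinAt) fun x hx => ?_
    rw [interior_Ici] at hx
    rw [(hd x).deriv]
    linarith [hprod x hx.le]
  have hwev : ∀ᶠ t in atTop, 0 < w t := hw1.eventually (lt_mem_nhds one_pos)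
  have hne : ∀ t ≥ 0, w t ≠ 0 := by
    intro t ht h0
    obtain ⟨x, hx, htx⟩ := (hwev.and (eventually_ge_atTop t)).exists
    have h := hsq (mem_Ici.2 ht) (mem_Ici.2 (le_trans ht htx)) htx
    have : 0 < Real.exp (-(2 * κ) * x) * w x ^ 2 := by positivity
    simp only [h0] at h
    linarith
  have hpos : ∀ t ≥ 0, 0 < w t := by
    intro t ht
    by_contra! hneg
    obtain ⟨x, hx, htx⟩ := (hwev.and (eventually_ge_atTop t)).exists
    obtain ⟨y, hy, hy0⟩ := intermediate_value_Icc htx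
      (fun z _ => (hw z).continuousAt.continuousWithinAt) ⟨hneg, hx.le⟩
    exact hne y (le_trans ht hy.1) hy0
  refine fun t ht => ⟨hpos t ht, ?_, ?_⟩
  · have : 0 < Real.exp (-(2 * κ) * t) * p t := by
      refine pos_of_hasDerivAt_neg_of_tendsto_zero (T := 0)
        (h := fun t => Real.exp (-(2 * κ) * t) * p t)
        (h' := fun t => -(Real.exp (-(2 * κ) * t) * (κ ^ 2 * Real.exp (-α * t) * w t)))
        (fun t _ => ?_) (fun t ht => ?_) ?_ ht
      · convert! (hE (2 * κ) t).mul (hp t) using 1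
        ring
      · have := hpos t ht.le
        rw [neg_lt_zero]
        positivity
      · simpa using (hElim (2 * κ) (by positivity)).mul hp0
    exact pos_of_mul_pos_right this (Real.exp_pos _).le
  · have : 0 < Real.exp (-κ * t) * (κ * w t - p t) := by
      refine pos_of_hasDerivAt_neg_of_tendsto_zero (T := 0)
        (h := fun t => Real.exp (-κ * t) * (κ * w t - p t))
        (h' := fun t => -(Real.exp (-κ * t) * (κ ^ 2 * (1 - Real.exp (-α * t)) * w t)))
        (fun t _ => ?_) (fun t ht => ?_) ?_ ht
      · convert! (hE κ t).mul (hg t) using 1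
        ring
      · have := hpos t ht.le
        have := sub_pos.2 (hs t ht)
        rw [neg_lt_zero]
        positivity
      · simpa using (hElim κ hκ).mul hglim
    exact sub_pos.1 (pos_of_mul_pos_right this (Real.exp_pos _).le)

open Filter Set Topology in
/-- Two solutions of `η' = a(t) + η²` with values in `(0, κ)`, one of which tends to `κ`,
coincide. -/
theorem riccati_eqOn_of_tendsto {κ : ℝ} (hκ : 0 < κ) {a η ζ : ℝ → ℝ}
    (hη : ∀ t ≥ 0, HasDerivAt η (a t + η t ^ 2) t)
    (hζ : ∀ t ≥ 0, HasDerivAt ζ (a t + ζ t ^ 2) t)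
    (hηb : ∀ t > 0, 0 < η t ∧ η t < κ) (hζb : ∀ t > 0, 0 < ζ t ∧ ζ t < κ)
    (hlim : Tendsto ζ atTop (𝓝 κ)) : EqOn η ζ (Ici 0) := by
  have hd : ∀ t ≥ 0, HasDerivAt (fun t => (η t - ζ t) ^ 2)
      (2 * (η t + ζ t) * (η t - ζ t) ^ 2) t := fun t ht => by
    convert! ((hη t ht).sub (hζ t ht)).pow 2 using 1
    simp
    ring
  have hmono : MonotoneOn (fun t => (η t - ζ t) ^ 2) (Ici 0) := by
    refine monotoneOn_of_deriv_nonneg (convex_Ici 0)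
      (fun x hx => (hd x hx).continuousAt.continuousWithinAt) (fun x hx => ?_) fun x hx => ?_
    · rw [interior_Ici] at hx
      exact (hd x hx.le).differentiableAt.differentiableWithinAt
    · rw [interior_Ici] at hx
      rw [(hd x hx.le).deriv]
      have := (hηb x hx).1
      have := (hζb x hx).1
      positivity
  obtain ⟨T, hT0, hT⟩ : ∃ T > 0, ∀ t ≥ T, κ / 2 < ζ t := by
    obtain ⟨T, hT⟩ := eventually_atTop.1 (hlim.eventually (lt_mem_nhds (half_lt_self hκ)))
    exact ⟨max T 1, by positivity, fun t ht => hT t ((le_max_left _ _).trans ht)⟩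
  have hE : ∀ t : ℝ, HasDerivAt (fun t => Real.exp (-κ * t)) (Real.exp (-κ * t) * (-κ)) t :=
    fun t => by simpa using ((hasDerivAt_id t).const_mul (-κ)).exp
  have hElim : Tendsto (fun t => Real.exp (-κ * t)) atTop (𝓝 0) :=
    Real.tendsto_exp_atBot.comp (tendsto_id.const_mul_atTop_of_neg (neg_lt_zero.2 hκ))
  have hzero : ∀ t ≥ T, (η t - ζ t) ^ 2 = 0 := by
    intro t ht
    have : 0 ≤ -(Real.exp (-κ * t) * (η t - ζ t) ^ 2) := by
      refine nonneg_of_hasDerivAt_nonpos_of_tendsto_zero (T := T)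
        (h := fun t => -(Real.exp (-κ * t) * (η t - ζ t) ^ 2))
        (h' := fun t => -(Real.exp (-κ * t) * ((2 * (η t + ζ t) - κ) * (η t - ζ t) ^ 2)))
        (fun t ht => ?_) (fun t ht => ?_) ?_ ht
      · convert! ((hE t).mul (hd t (hT0.le.trans ht))).neg using 1
        ring
      · have h1 : 0 < 2 * (η t + ζ t) - κ := by
          linarith [hT t ht.le, (hηb t (hT0.trans ht)).1]
        rw [neg_nonpos]
        positivity
      · rw [← neg_zero]
        refine (squeeze_zero' (g := fun t => Real.exp (-κ * t) * κ ^ 2)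
          (Eventually.of_forall fun t => by positivity) ?_ ?_).neg
        · filter_upwards [eventually_gt_atTop 0] with t ht
          have := hηb t ht
          have := hζb t ht
          gcongr ?_ * ?_
          exact sq_le_sq' (by linarith) (by linarith)
        · simpa using hElim.mul_const (κ ^ 2)
    have h2 : Real.exp (-κ * t) * (η t - ζ t) ^ 2 ≤ 0 := by linarith
    exact le_antisymm (nonpos_of_mul_nonpos_right h2 (Real.exp_pos _)) (sq_nonneg _)
  intro t ht
  have h := hmono ht (mem_Ici.2 (hT0.le.trans (le_max_right t T))) (le_max_left t T)
  simp only [hzero _ (le_max_right t T)] at h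
  exact sub_eq_zero.1 (pow_eq_zero_iff two_ne_zero |>.1 (le_antisymm h (sq_nonneg _)))


/-- For `λ > 0`, `α > 0`, `κ = √(1 + λ²/4)` and
`a(t) = κ²e^{−αt} − κ²`, the Riccati equation `η′ = a(t) + η²` has a solution
`η_s` on `[0, ∞)` with `0 < η_s(t) < κ` for `t > 0` and `η_s(t) → κ` as
`t → ∞`; it is the unique solution on `[0, ∞)` whose values remain in
`(0, κ)`. -/
theorem riccati_saddle_node_solution
    (lam α κ : ℝ) (hlam : 0 < lam) (hα : 0 < α)
    (hκ : κ = Real.sqrt (1 + lam ^ 2 / 4))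
    (a : ℝ → ℝ) (ha : ∀ t, a t = κ ^ 2 * Real.exp (-α * t) - κ ^ 2) :
    ∃ ηs : ℝ → ℝ,
      (∀ t ∈ Set.Ici (0 : ℝ), HasDerivAt ηs (a t + (ηs t) ^ 2) t) ∧
      (∀ t > (0 : ℝ), 0 < ηs t ∧ ηs t < κ) ∧
      Filter.Tendsto ηs Filter.atTop (nhds κ) ∧
      (∀ η : ℝ → ℝ,
        (∀ t ∈ Set.Ici (0 : ℝ), HasDerivAt η (a t + (η t) ^ 2) t) →
        (∀ t > (0 : ℝ), 0 < η t ∧ η t < κ) →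
        ∀ t ∈ Set.Ici (0 : ℝ), η t = ηs t) := by

  have hκ0 : 0 < κ := by rw [hκ]; positivity
  obtain ⟨w, p, hw, hp, hw1, hp0, hpos⟩ := exists_positive_linear_solution hκ0 hα
  have hd : ∀ t ∈ Set.Ici (0 : ℝ),
      HasDerivAt (fun t => κ - p t / w t) (a t + (κ - p t / w t) ^ 2) t := by
    intro t ht
    have hne : w t ≠ 0 := (hpos t ht).1.ne'
    convert! ((hp t).div (hw t) hne).const_sub κ using 1
    rw [ha]
    field_simp
    ring
  have hb : ∀ t > (0 : ℝ), 0 < κ - p t / w t ∧ κ - p t / w t < κ := by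
    intro t ht
    obtain ⟨h1, h2, h3⟩ := hpos t ht.le
    exact ⟨sub_pos.2 ((div_lt_iff₀ h1).2 h3), sub_lt_self _ (div_pos h2 h1)⟩
  have hlim : Filter.Tendsto (fun t => κ - p t / w t) Filter.atTop (nhds κ) := by
    simpa using (hp0.div hw1 one_ne_zero).const_sub κ
  exact ⟨_, hd, hb, hlim, fun η hη hηb => riccati_eqOn_of_tendsto hκ0 hη hd hηb hb hlim⟩
end

section
/- Let λ, α, β ∈ ℝ and let c₁, c₂ be real constants with c₁ > c₂² and c₂ > 0. Define V(x, y) = c₁x²/2 + x⁴/4 + c₂xy + y²/2 and C = c₁ + 1 − λc₂. Along any solution t ↦ (x(t), y(t), z(t)) of the universal normal form, the derivative of t ↦ V(x(t), y(t)) equals −(c₂(z − 1)x² − (C − z)xy + (λ − c₂)y²) − c₂x⁴. Moreover, if λ > c₂, z > 1 and (C − z)² < 4c₂(z − 1)(λ − c₂), then this derivative is strictly negative whenever (x, y) ≠ (0, 0). -/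
/-- A binary quadratic form with positive leading coefficient and negative discriminant is
positive away from the origin. -/
theorem binary_quadratic_form_pos {a b d x y : ℝ} (ha : 0 < a) (hdisc : b ^ 2 < 4 * a * d)
    (hxy : (x, y) ≠ (0, 0)) : 0 < a * x ^ 2 - b * (x * y) + d * y ^ 2 := by
  have key : 4 * a * (a * x ^ 2 - b * (x * y) + d * y ^ 2) =
      (2 * a * x - b * y) ^ 2 + (4 * a * d - b ^ 2) * y ^ 2 := by ring
  refine pos_of_mul_pos_right (a := 4 * a) ?_ (by positivity)
  rw [key]
  rcases eq_or_ne y 0 with rfl | hy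
  · have hx : x ≠ 0 := by
      rintro rfl
      exact hxy rfl
    have : 0 < (2 * a * x) ^ 2 := by positivity
    simpa using this
  · have : 0 < 4 * a * d - b ^ 2 := sub_pos.mpr hdisc
    positivity


/-- With `c₁ > c₂² > 0`, `V(x,y) = c₁x²/2 + x⁴/4 + c₂xy + y²/2`
and `C = c₁ + 1 − λc₂`, along any solution of the universal normal form the
derivative of `t ↦ V(x(t), y(t))` equals
`−(c₂(z−1)x² − (C−z)xy + (λ−c₂)y²) − c₂x⁴`; this is strictly negative at
every time where `λ > c₂`, `z > 1`, `(C − z)² < 4c₂(z−1)(λ−c₂)` and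
`(x, y) ≠ (0, 0)`. -/
theorem UNF_layer_Lyapunov_function
    (lam α β c₁ c₂ : ℝ) (hc₁ : c₂ ^ 2 < c₁) (hc₂ : 0 < c₂)
    (C : ℝ) (hC : C = c₁ + 1 - lam * c₂)
    (V : ℝ → ℝ → ℝ)
    (hV : ∀ x y : ℝ, V x y = c₁ * x ^ 2 / 2 + x ^ 4 / 4 + c₂ * x * y + y ^ 2 / 2)
    (I : Set ℝ) (x y z : ℝ → ℝ)
    (hsol : ∀ t ∈ I,
      HasDerivAt x (y t) t ∧
      HasDerivAt y (-(((x t) ^ 2 + z t - 1) * x t) - lam * y t) t ∧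
      HasDerivAt z (-α * z t + β * (x t) ^ 2) t) :
    ∀ t ∈ I,
      HasDerivAt (fun s => V (x s) (y s))
        (-(c₂ * (z t - 1) * (x t) ^ 2 - (C - z t) * (x t * y t) +
            (lam - c₂) * (y t) ^ 2) - c₂ * (x t) ^ 4) t ∧
      (c₂ < lam → 1 < z t →
        (C - z t) ^ 2 < 4 * c₂ * (z t - 1) * (lam - c₂) →
        (x t, y t) ≠ (0, 0) →
        -(c₂ * (z t - 1) * (x t) ^ 2 - (C - z t) * (x t * y t) +
            (lam - c₂) * (y t) ^ 2) - c₂ * (x t) ^ 4 < 0) := by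
  intro t ht
  obtain ⟨hx, hy, -⟩ := hsol t ht
  constructor
  · simp only [hV]
    refine HasDerivAt.congr_deriv ((((((hx.pow 2).const_mul c₁).div_const 2).add ((hx.pow 4).div_const 4)).add
      ((hx.const_mul c₂).mul hy)).add ((hy.pow 2).div_const 2)) ?_
    subst hC
    push_cast
    ring
  · intro _ hz hdisc hxy
    have ha : 0 < c₂ * (z t - 1) := mul_pos hc₂ (sub_pos.mpr hz)
    have hQ := binary_quadratic_form_pos ha (b := C - z t) (d := lam - c₂)
      (by linarith) hxy
    have hx4 : 0 ≤ c₂ * x t ^ 4 := by positivity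
    linarith
end

section
/- Let λ ≥ 0, α ∈ ℝ and β > 0. Define V(x, y, z) = x⁴/4 + (z − 1)x²/2 + y²/2 − (α/(4β))z². Along any solution t ↦ (x(t), y(t), z(t)) of the universal normal form, the derivative of t ↦ V(x(t), y(t), z(t)) equals −λy² + (−αz + βx²)²/(2β). In particular, if λ = 0 then V is nondecreasing along every solution, and strictly increasing at every time where −αz + βx² ≠ 0. -/
/-- For `λ ≥ 0`, `β > 0` and
`V(x,y,z) = x⁴/4 + (z−1)x²/2 + y²/2 − (α/(4β))z²`, along any solution of the
universal normal form the derivative of `t ↦ V(x(t),y(t),z(t))` equals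
`−λy² + (−αz + βx²)²/(2β)`; in particular for `λ = 0` this is nonnegative,
and strictly positive wherever `−αz + βx² ≠ 0`. -/
theorem UNF_global_instability_Lyapunov
    (lam α β : ℝ) (hlam : 0 ≤ lam) (hβ : 0 < β)
    (V : ℝ → ℝ → ℝ → ℝ)
    (hV : ∀ x y z : ℝ,
      V x y z = x ^ 4 / 4 + (z - 1) * x ^ 2 / 2 + y ^ 2 / 2 - α / (4 * β) * z ^ 2)
    (I : Set ℝ) (x y z : ℝ → ℝ)
    (hsol : ∀ t ∈ I,
      HasDerivAt x (y t) t ∧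
      HasDerivAt y (-(((x t) ^ 2 + z t - 1) * x t) - lam * y t) t ∧
      HasDerivAt z (-α * z t + β * (x t) ^ 2) t) :
    ∀ t ∈ I,
      HasDerivAt (fun s => V (x s) (y s) (z s))
        (-lam * (y t) ^ 2 + (-α * z t + β * (x t) ^ 2) ^ 2 / (2 * β)) t ∧
      (lam = 0 →
        0 ≤ -lam * (y t) ^ 2 + (-α * z t + β * (x t) ^ 2) ^ 2 / (2 * β) ∧
        (-α * z t + β * (x t) ^ 2 ≠ 0 →
          0 < -lam * (y t) ^ 2 + (-α * z t + β * (x t) ^ 2) ^ 2 / (2 * β))) := by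
  intro t ht
  obtain ⟨hx, hy, hz⟩ := hsol t ht
  refine ⟨?_, ?_⟩
  · simp only [hV]
    refine (((((hx.fun_pow 4).div_const 4).fun_add
      (((hz.sub_const 1).fun_mul (hx.fun_pow 2)).div_const 2)).fun_add
      ((hy.fun_pow 2).div_const 2)).fun_sub
      ((hz.fun_pow 2).const_mul (α / (4 * β)))).congr_deriv ?_
    push_cast
    field_simp
    ring
  · rintro rfl
    rw [neg_zero, zero_mul, zero_add]
    exact ⟨by positivity, fun h => by positivity⟩
end
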